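/- arXiv:2509.13748 — 3 statements merged into one kernel-verified Lean document; each statement's English description precedes it below -/
import Mathlib

section
/- For every pair (ξ, ζ) ∈ D^{J+K} (ξ with components ξ_1,…,ξ_J and ζ with components ζ_1,…,ζ_K), there exists a unique y ∈ D^K satisfying equation (A.1), i.e. for all k ∈ [K] and all t ≥ 0: y_k(t) = ζ_k(t) − η_k ∫_0^t y_k(s) ds − Σ_{j=1}^J p_{jk} · ψ( ξ_j + Σ_{l=1}^K q_{lj} η_l ∫_0^· y_l(s) ds )(t). -/
open MeasureTheory Set Filter

/-- One-sided reflection map: `psi x t = sup_{s ∈ [0,t]} max (-x s) 0`. -/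
noncomputable def psi (x : ℝ → ℝ) (t : ℝ) : ℝ :=
  sSup ((fun s => max (-x s) 0) '' Set.Icc 0 t)

/-- `phi x t = x t + psi x t`. -/
noncomputable def phi (x : ℝ → ℝ) (t : ℝ) : ℝ := x t + psi x t

/-- Càdlàg on `[0,∞)`: right continuous on `[0,∞)`, left limits on `(0,∞)`. -/
def Cadlag (x : ℝ → ℝ) : Prop :=
  (∀ t : ℝ, 0 ≤ t → ContinuousWithinAt x (Set.Ici t) t) ∧
  (∀ t : ℝ, 0 < t → ∃ L : ℝ, Filter.Tendsto x (nhdsWithin t (Set.Iio t)) (nhds L))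

/-- Càdlàg on `[0,T]`: right continuous on `[0,T)`, left limits on `(0,T]`. -/
def CadlagOn (x : ℝ → ℝ) (T : ℝ) : Prop :=
  (∀ t : ℝ, 0 ≤ t → t < T → ContinuousWithinAt x (Set.Ici t) t) ∧
  (∀ t : ℝ, 0 < t → t ≤ T → ∃ L : ℝ, Filter.Tendsto x (nhdsWithin t (Set.Iio t)) (nhds L))

/-- Sup norm of `x` on `[0,T]`. -/
noncomputable def supNorm (x : ℝ → ℝ) (T : ℝ) : ℝ :=
  sSup ((fun t => |x t|) '' Set.Icc 0 T)

/-- `y` is a càdlàg solution of equation (A.1) on `[0,∞)` for input `(ξ, ζ)`. -/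
def IsSolA1 {J K : ℕ} (η : Fin K → ℝ) (p : Fin J → Fin K → ℝ) (q : Fin K → Fin J → ℝ)
    (ξ : Fin J → ℝ → ℝ) (ζ : Fin K → ℝ → ℝ) (y : Fin K → ℝ → ℝ) : Prop :=
  (∀ k, Cadlag (y k)) ∧
  ∀ k, ∀ t : ℝ, 0 ≤ t →
    y k t = ζ k t - η k * (∫ s in (0:ℝ)..t, y k s)
      - ∑ j, p j k *
          psi (fun r => ξ j r + ∑ l, q l j * η l * (∫ s in (0:ℝ)..r, y l s)) t

namespace Cadlag

open Topology

variable {x x' : ℝ → ℝ}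

theorem of_continuousOn (h : ContinuousOn x (Ici 0)) : Cadlag x :=
  ⟨fun t ht => (h t ht).mono (Ici_subset_Ici.2 ht), fun t ht =>
    ⟨x t, ((h.continuousAt (Ici_mem_nhds ht)).tendsto).mono_left nhdsWithin_le_nhds⟩⟩

theorem const (c : ℝ) : Cadlag fun _ => c := of_continuousOn continuousOn_const

theorem add (hx : Cadlag x) (hx' : Cadlag x') : Cadlag fun t => x t + x' t := by
  refine ⟨fun t ht => (hx.1 t ht).add (hx'.1 t ht), fun t ht => ?_⟩
  obtain ⟨a, ha⟩ := hx.2 t ht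
  obtain ⟨b, hb⟩ := hx'.2 t ht
  exact ⟨a + b, ha.add hb⟩

theorem const_mul (c : ℝ) (hx : Cadlag x) : Cadlag fun t => c * x t := by
  refine ⟨fun t ht => continuousWithinAt_const.mul (hx.1 t ht), fun t ht => ?_⟩
  obtain ⟨a, ha⟩ := hx.2 t ht
  exact ⟨c * a, ha.const_mul c⟩

theorem sub (hx : Cadlag x) (hx' : Cadlag x') : Cadlag fun t => x t - x' t := by
  simpa [sub_eq_add_neg] using hx.add (hx'.const_mul (-1))

theorem abs (hx : Cadlag x) : Cadlag fun t => |x t| := by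
  refine ⟨fun t ht => (hx.1 t ht).abs, fun t ht => ?_⟩
  obtain ⟨a, ha⟩ := hx.2 t ht
  exact ⟨|a|, ha.abs⟩

theorem sum {ι : Type*} (s : Finset ι) {f : ι → ℝ → ℝ} (hf : ∀ i, Cadlag (f i)) :
    Cadlag fun t => ∑ i ∈ s, f i t := by
  refine ⟨fun t ht => tendsto_finsetSum s fun i _ => (hf i).1 t ht, fun t ht => ?_⟩
  choose a ha using fun i => (hf i).2 t ht
  exact ⟨∑ i ∈ s, a i, tendsto_finsetSum s fun i _ => ha i⟩

/-- A càdlàg function is bounded on compact intervals. -/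
theorem exists_bound (hx : Cadlag x) (T : ℝ) : ∃ C, ∀ t ∈ Icc 0 T, |x t| ≤ C := by
  have of_tendsto : ∀ {l : Filter ℝ} {a : ℝ}, Tendsto x l (𝓝 a) → ∀ᶠ t in l, |x t| ≤ |a| + 1 :=
    fun h => h.abs.eventually_le_const (lt_add_one _)
  refine isCompact_Icc.induction_on (p := fun s => ∃ C, ∀ t ∈ s, |x t| ≤ C) ⟨0, by simp⟩
    (fun s t hst ⟨C, hC⟩ => ⟨C, fun r hr => hC r (hst hr)⟩) ?_ ?_
  · rintro s t ⟨C, hC⟩ ⟨D, hD⟩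
    exact ⟨max C D, fun r hr => hr.elim (fun h => (hC r h).trans (le_max_left _ _))
      fun h => (hD r h).trans (le_max_right _ _)⟩
  · intro t ht
    have hr := of_tendsto (hx.1 t ht.1)
    rcases ht.1.eq_or_lt with h0 | h0
    · subst h0
      exact ⟨_, nhdsWithin_mono _ Icc_subset_Ici_self hr, _, fun r hr => hr⟩
    · obtain ⟨a, ha⟩ := hx.2 t h0
      have hl := of_tendsto ha
      refine ⟨{r | |x r| ≤ max (|a| + 1) (|x t| + 1)}, nhdsWithin_le_nhds ?_, _, fun r hr => hr⟩
      rw [← nhdsLT_sup_nhdsGE, mem_sup]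
      exact ⟨hl.mono fun r h => h.trans (le_max_left _ _),
        hr.mono fun r h => h.trans (le_max_right _ _)⟩

theorem aestronglyMeasurable (hx : Cadlag x) (T : ℝ) :
    AEStronglyMeasurable x (volume.restrict (Ioc 0 T)) := by
  have hmeas : ∀ n : ℕ, Measurable fun t : ℝ => x ((⌊((n : ℝ) + 1) * t⌋ + 1) / ((n : ℝ) + 1)) :=
    fun n => (measurable_from_top (f := fun m : ℤ => x ((m + 1) / ((n : ℝ) + 1)))).comp
      (Int.measurable_floor.comp (measurable_const.mul measurable_id))
  refine aestronglyMeasurable_of_tendsto_ae atTop (fun n => (hmeas n).aestronglyMeasurable) ?_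
  refine (ae_restrict_mem measurableSet_Ioc).mono fun t ht => ?_
  refine (hx.1 t ht.1.le).tendsto.comp (tendsto_nhdsWithin_iff.2 ⟨?_, ?_⟩)
  · have hlim : Tendsto (fun n : ℕ => t + 1 / ((n : ℝ) + 1)) atTop (𝓝 t) := by
      simpa using tendsto_const_nhds.add (tendsto_one_div_add_atTop_nhds_zero_nat (𝕜 := ℝ))
    refine tendsto_of_tendsto_of_tendsto_of_le_of_le tendsto_const_nhds hlim ?_ ?_
    · intro n
      have hn : (0 : ℝ) < n + 1 := by positivity
      change t ≤ _ / _
      rw [le_div_iff₀ hn]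
      linarith [Int.lt_floor_add_one (((n : ℝ) + 1) * t)]
    · intro n
      have hn : (0 : ℝ) < n + 1 := by positivity
      change _ / _ ≤ t + 1 / _
      rw [div_le_iff₀ hn, add_mul t, one_div_mul_cancel hn.ne']
      linarith [Int.floor_le (((n : ℝ) + 1) * t)]
  · refine Eventually.of_forall fun n => ?_
    have hn : (0 : ℝ) < n + 1 := by positivity
    change t ≤ _ / _
    rw [le_div_iff₀ hn]
    linarith [Int.lt_floor_add_one (((n : ℝ) + 1) * t)]

theorem intervalIntegrable (hx : Cadlag x) {t : ℝ} (ht : 0 ≤ t) :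
    IntervalIntegrable x volume 0 t := by
  obtain ⟨C, hC⟩ := hx.exists_bound t
  rw [intervalIntegrable_iff_integrableOn_Ioc_of_le ht]
  exact IntegrableOn.of_bound measure_Ioc_lt_top (hx.aestronglyMeasurable t) C
    ((ae_restrict_mem measurableSet_Ioc).mono fun s hs => hC s (Ioc_subset_Icc_self hs))

theorem primitive (hx : Cadlag x) : Cadlag fun t => ∫ s in (0:ℝ)..t, x s := by
  refine of_continuousOn fun t ht => ?_
  have ht' : (0 : ℝ) ≤ t := ht
  have h := intervalIntegral.continuousOn_primitive_interval'
    (hx.intervalIntegrable (by linarith : (0 : ℝ) ≤ t + 1)) left_mem_uIcc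
  rw [uIcc_of_le (by linarith)] at h
  refine (h t ⟨ht', by linarith⟩).mono_of_mem_nhdsWithin ?_
  exact mem_nhdsWithin.2 ⟨Iio (t + 1), isOpen_Iio, lt_add_one t, fun s hs => ⟨hs.2, hs.1.le⟩⟩

/-- A locally uniform limit of càdlàg functions is càdlàg. -/
theorem of_tendstoUniformlyOn {F : ℕ → ℝ → ℝ} (hF : ∀ n, Cadlag (F n))
    (h : ∀ T, TendstoUniformlyOn F x atTop (Icc 0 T)) : Cadlag x := by
  refine ⟨fun t ht => ?_, fun t ht => ?_⟩
  · refine continuousWithinAt_of_locally_uniform_approx_of_continuousWithinAt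
      self_mem_Ici fun u hu => ?_
    obtain ⟨n, hn⟩ := (h (t + 1) u hu).exists
    exact ⟨Icc t (t + 1), Icc_mem_nhdsGE (lt_add_one t), F n, (hF n).1 t ht,
      fun s hs => hn s ⟨ht.trans hs.1, hs.2⟩⟩
  · rw [← cauchy_map_iff_exists_tendsto, Metric.cauchy_iff]
    refine ⟨inferInstance, fun ε hε => ?_⟩
    obtain ⟨n, hn⟩ := (Metric.tendstoUniformlyOn_iff.1 (h t) (ε / 4) (by positivity)).exists
    obtain ⟨a, ha⟩ := (hF n).2 t ht
    have hev : ∀ᶠ s in 𝓝[<] t, dist (x s) a < ε / 2 := by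
      filter_upwards [Metric.tendsto_nhds.1 ha (ε / 4) (by positivity), Ioo_mem_nhdsLT ht]
        with s hs hs'
      linarith [dist_triangle (x s) (F n s) a, hn s ⟨hs'.1.le, hs'.2.le⟩]
    refine ⟨Metric.ball a (ε / 2), hev, fun y hy z hz => ?_⟩
    rw [Metric.mem_ball] at hy hz
    linarith [dist_triangle_right y z a]

theorem bddAbove_neg_part (hx : Cadlag x) (t : ℝ) :
    BddAbove ((fun s => max (-x s) 0) '' Icc 0 t) := by
  obtain ⟨C, hC⟩ := hx.exists_bound t
  refine ⟨max C 0, ?_⟩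
  rintro _ ⟨s, hs, rfl⟩
  exact max_le_max ((neg_le_abs _).trans (hC s hs)) le_rfl

end Cadlag

theorem psi_nonneg (x : ℝ → ℝ) (t : ℝ) : 0 ≤ psi x t :=
  Real.sSup_nonneg (by rintro _ ⟨s, _, rfl⟩; exact le_max_right _ _)

theorem psi_le {x : ℝ → ℝ} {t a : ℝ} (ha : 0 ≤ a) (h : ∀ s ∈ Icc 0 t, -x s ≤ a) :
    psi x t ≤ a :=
  Real.sSup_le (by rintro _ ⟨s, hs, rfl⟩; exact max_le (h s hs) ha) ha

theorem Cadlag.neg_le_psi {x : ℝ → ℝ} (hx : Cadlag x) {s t : ℝ} (hs : s ∈ Icc 0 t) :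
    -x s ≤ psi x t :=
  (le_max_left _ _).trans (le_csSup (hx.bddAbove_neg_part t) ⟨s, hs, rfl⟩)

theorem Cadlag.psi_monotone {x : ℝ → ℝ} (hx : Cadlag x) : Monotone (psi x) := fun _ _ hst =>
  psi_le (psi_nonneg _ _) fun _ hr => hx.neg_le_psi ⟨hr.1, hr.2.trans hst⟩

theorem Cadlag.psi {x : ℝ → ℝ} (hx : Cadlag x) : Cadlag (psi x) := by
  refine ⟨fun t ht => ?_, fun t _ => ⟨_, hx.psi_monotone.tendsto_nhdsLT t⟩⟩
  refine Metric.tendsto_nhds.2 fun ε hε => ?_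
  obtain ⟨u, hu, hsub⟩ := mem_nhdsGE_iff_exists_Ico_subset.1
    ((hx.1 t ht).eventually (lt_mem_nhds (sub_lt_self (x t) (half_pos hε))))
  filter_upwards [Ico_mem_nhdsGE hu] with r hr
  have hle : _root_.psi x r ≤ _root_.psi x t + ε / 2 := by
    refine psi_le (by linarith [psi_nonneg x t]) fun s hs => ?_
    rcases le_total s t with h | h
    · linarith [hx.neg_le_psi ⟨hs.1, h⟩]
    · have h1 : x t - ε / 2 < x s := hsub ⟨h, hs.2.trans_lt hr.2⟩
      linarith [hx.neg_le_psi ⟨ht, le_refl t⟩]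
  rw [Real.dist_eq, abs_lt]
  constructor <;> linarith [hx.psi_monotone hr.1]

theorem abs_psi_sub_psi_le {x x' : ℝ → ℝ} (hx : Cadlag x) (hx' : Cadlag x') {t a : ℝ}
    (ha : 0 ≤ a) (h : ∀ s ∈ Icc 0 t, |x s - x' s| ≤ a) : |psi x t - psi x' t| ≤ a := by
  rw [abs_le]
  have h1 : psi x t ≤ psi x' t + a := psi_le (by linarith [psi_nonneg x' t]) fun s hs => by
    linarith [hx'.neg_le_psi hs, (abs_le.1 (h s hs)).1]
  have h2 : psi x' t ≤ psi x t + a := psi_le (by linarith [psi_nonneg x t]) fun s hs => by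
    linarith [hx.neg_le_psi hs, (abs_le.1 (h s hs)).2]
  constructor <;> linarith

/-- Iterating the Volterra inequality `f (n + 1) t ≤ L * ∫ s in 0..t, f n s`. -/
theorem le_pow_div_factorial_of_le_integral {f : ℕ → ℝ → ℝ} {L C T : ℝ} (hL : 0 ≤ L)
    (hf : ∀ n, ∀ t, 0 ≤ t → IntervalIntegrable (f n) volume 0 t)
    (h0 : ∀ t ∈ Icc 0 T, f 0 t ≤ C)
    (hstep : ∀ n, ∀ t ∈ Icc 0 T, f (n + 1) t ≤ L * ∫ s in (0:ℝ)..t, f n s) (n : ℕ) :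
    ∀ t ∈ Icc 0 T, f n t ≤ C * ((L * t) ^ n / n.factorial) := by
  induction n with
  | zero => simpa using h0
  | succ n ih =>
    intro t ht
    calc f (n + 1) t ≤ L * ∫ s in (0:ℝ)..t, f n s := hstep n t ht
      _ ≤ L * ∫ s in (0:ℝ)..t, C * ((L * s) ^ n / n.factorial) := by
        refine mul_le_mul_of_nonneg_left ?_ hL
        refine intervalIntegral.integral_mono_on ht.1 (hf n t ht.1)
          (Continuous.intervalIntegrable (by fun_prop) _ _) fun s hs => ih s ⟨hs.1, hs.2.trans ht.2⟩
      _ = C * ((L * t) ^ (n + 1) / (n + 1).factorial) := by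
        simp only [mul_pow, intervalIntegral.integral_const_mul, intervalIntegral.integral_div,
          integral_pow, Nat.factorial_succ]
        push_cast
        field_simp
        ring

section FixedPoint

variable {J K : ℕ} (η : Fin K → ℝ) (p : Fin J → Fin K → ℝ) (q : Fin K → Fin J → ℝ)
  (ξ : Fin J → ℝ → ℝ) (ζ : Fin K → ℝ → ℝ)

/-- The argument of the reflection map at station `j` in equation (A.1). -/
noncomputable def netInput (y : Fin K → ℝ → ℝ) (j : Fin J) (r : ℝ) : ℝ :=
  ξ j r + ∑ l, q l j * η l * (∫ s in (0:ℝ)..r, y l s)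

/-- The right-hand side of equation (A.1). -/
noncomputable def picardMap (y : Fin K → ℝ → ℝ) (k : Fin K) (t : ℝ) : ℝ :=
  ζ k t - η k * (∫ s in (0:ℝ)..t, y k s) - ∑ j, p j k * psi (netInput η q ξ y j) t

/-- A Lipschitz constant for `picardMap`. -/
def picardConst : ℝ := ∑ k, (η k + ∑ j, p j k * ∑ l, q l j * η l)

/-- The pointwise `ℓ¹` distance of two vector-valued functions. -/
def l1Dist (y y' : Fin K → ℝ → ℝ) (t : ℝ) : ℝ := ∑ k, |y k t - y' k t|

variable {η p q ξ ζ} {y y' : Fin K → ℝ → ℝ}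

theorem Cadlag.netInput (hξ : ∀ j, Cadlag (ξ j)) (hy : ∀ k, Cadlag (y k)) (j : Fin J) :
    Cadlag (netInput η q ξ y j) :=
  (hξ j).add (Cadlag.sum _ fun l => (hy l).primitive.const_mul _)

theorem Cadlag.picardMap (hξ : ∀ j, Cadlag (ξ j)) (hζ : ∀ k, Cadlag (ζ k))
    (hy : ∀ k, Cadlag (y k)) (k : Fin K) : Cadlag (picardMap η p q ξ ζ y k) :=
  ((hζ k).sub ((hy k).primitive.const_mul _)).sub
    (Cadlag.sum _ fun j => (Cadlag.netInput hξ hy j).psi.const_mul _)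

theorem Cadlag.l1Dist (hy : ∀ k, Cadlag (y k)) (hy' : ∀ k, Cadlag (y' k)) :
    Cadlag (l1Dist y y') :=
  Cadlag.sum _ fun k => ((hy k).sub (hy' k)).abs

theorem picardConst_nonneg (hη : ∀ k, 0 ≤ η k) (hp : ∀ j k, 0 ≤ p j k) (hq : ∀ k j, 0 ≤ q k j) :
    0 ≤ picardConst η p q :=
  Finset.sum_nonneg fun k _ => add_nonneg (hη k) <| Finset.sum_nonneg fun j _ =>
    mul_nonneg (hp j k) <| Finset.sum_nonneg fun l _ => mul_nonneg (hq l j) (hη l)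

theorem abs_sub_le_l1Dist (y y' : Fin K → ℝ → ℝ) (k : Fin K) (t : ℝ) :
    |y k t - y' k t| ≤ l1Dist y y' t :=
  Finset.single_le_sum (f := fun k => |y k t - y' k t|) (fun _ _ => abs_nonneg _)
    (Finset.mem_univ k)

theorem l1Dist_nonneg (y y' : Fin K → ℝ → ℝ) (t : ℝ) : 0 ≤ l1Dist y y' t :=
  Finset.sum_nonneg fun _ _ => abs_nonneg _

theorem abs_integral_sub_integral_le (hy : ∀ k, Cadlag (y k)) (hy' : ∀ k, Cadlag (y' k))
    (k : Fin K) {r t : ℝ} (hr : r ∈ Icc 0 t) :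
    |(∫ s in (0:ℝ)..r, y k s) - ∫ s in (0:ℝ)..r, y' k s| ≤ ∫ s in (0:ℝ)..t, l1Dist y y' s := by
  have ht := hr.1.trans hr.2
  rw [← intervalIntegral.integral_sub ((hy k).intervalIntegrable hr.1)
    ((hy' k).intervalIntegrable hr.1)]
  calc |∫ s in (0:ℝ)..r, (y k s - y' k s)| ≤ ∫ s in (0:ℝ)..r, |y k s - y' k s| :=
        intervalIntegral.abs_integral_le_integral_abs hr.1
    _ ≤ ∫ s in (0:ℝ)..r, l1Dist y y' s :=
        intervalIntegral.integral_mono_on hr.1 (((hy k).sub (hy' k)).abs.intervalIntegrable hr.1)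
          ((Cadlag.l1Dist hy hy').intervalIntegrable hr.1) fun s _ => abs_sub_le_l1Dist y y' k s
    _ ≤ ∫ s in (0:ℝ)..t, l1Dist y y' s :=
        intervalIntegral.integral_mono_interval le_rfl hr.1 hr.2
          (Eventually.of_forall fun s => l1Dist_nonneg y y' s)
          ((Cadlag.l1Dist hy hy').intervalIntegrable ht)

theorem l1Dist_picardMap_le (hη : ∀ k, 0 ≤ η k) (hp : ∀ j k, 0 ≤ p j k) (hq : ∀ k j, 0 ≤ q k j)
    (hξ : ∀ j, Cadlag (ξ j)) (hy : ∀ k, Cadlag (y k)) (hy' : ∀ k, Cadlag (y' k))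
    {t : ℝ} (ht : 0 ≤ t) :
    l1Dist (picardMap η p q ξ ζ y) (picardMap η p q ξ ζ y') t ≤
      picardConst η p q * ∫ s in (0:ℝ)..t, l1Dist y y' s := by
  set A := ∫ s in (0:ℝ)..t, l1Dist y y' s with hA
  have hA0 : 0 ≤ A := intervalIntegral.integral_nonneg ht fun s _ => l1Dist_nonneg y y' s
  have hpsi : ∀ j, |psi (netInput η q ξ y j) t - psi (netInput η q ξ y' j) t| ≤
      (∑ l, q l j * η l) * A := by
    intro j
    refine abs_psi_sub_psi_le (Cadlag.netInput hξ hy j) (Cadlag.netInput hξ hy' j)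
      (mul_nonneg (Finset.sum_nonneg fun l _ => mul_nonneg (hq l j) (hη l)) hA0) fun r hr => ?_
    simp only [netInput, add_sub_add_left_eq_sub, ← Finset.sum_sub_distrib, ← mul_sub]
    rw [Finset.sum_mul]
    refine (Finset.abs_sum_le_sum_abs _ _).trans (Finset.sum_le_sum fun l _ => ?_)
    have hql := mul_nonneg (hq l j) (hη l)
    rw [abs_mul, abs_of_nonneg hql]
    exact mul_le_mul_of_nonneg_left (abs_integral_sub_integral_le hy hy' l hr) hql
  rw [picardConst, Finset.sum_mul]
  refine Finset.sum_le_sum fun k _ => ?_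
  have hsum : |∑ j, p j k * (psi (netInput η q ξ y j) t - psi (netInput η q ξ y' j) t)| ≤
      (∑ j, p j k * ∑ l, q l j * η l) * A := by
    rw [Finset.sum_mul]
    refine (Finset.abs_sum_le_sum_abs _ _).trans (Finset.sum_le_sum fun j _ => ?_)
    rw [abs_mul, abs_of_nonneg (hp j k), mul_assoc]
    exact mul_le_mul_of_nonneg_left (hpsi j) (hp j k)
  have hint : |η k * ((∫ s in (0:ℝ)..t, y k s) - ∫ s in (0:ℝ)..t, y' k s)| ≤ η k * A := by
    rw [abs_mul, abs_of_nonneg (hη k)]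
    exact mul_le_mul_of_nonneg_left (abs_integral_sub_integral_le hy hy' k ⟨ht, le_rfl⟩) (hη k)
  have heq : picardMap η p q ξ ζ y k t - picardMap η p q ξ ζ y' k t =
      -(η k * ((∫ s in (0:ℝ)..t, y k s) - ∫ s in (0:ℝ)..t, y' k s)) -
        ∑ j, p j k * (psi (netInput η q ξ y j) t - psi (netInput η q ξ y' j) t) := by
    simp only [picardMap, mul_sub, Finset.sum_sub_distrib]
    ring
  rw [heq, add_mul]
  refine (abs_sub _ _).trans ?_
  rw [abs_neg]
  exact add_le_add hint hsum

theorem isSolA1_unique (hη : ∀ k, 0 ≤ η k) (hp : ∀ j k, 0 ≤ p j k) (hq : ∀ k j, 0 ≤ q k j)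
    (hξ : ∀ j, Cadlag (ξ j)) (hy : IsSolA1 η p q ξ ζ y) (hy' : IsSolA1 η p q ξ ζ y')
    (k : Fin K) {t : ℝ} (ht : 0 ≤ t) : y k t = y' k t := by
  have hD := Cadlag.l1Dist hy.1 hy'.1
  obtain ⟨C, hC⟩ := hD.exists_bound t
  have hstep : ∀ s, 0 ≤ s →
      l1Dist y y' s ≤ picardConst η p q * ∫ r in (0:ℝ)..s, l1Dist y y' r := by
    intro s hs
    refine le_trans (le_of_eq ?_) (l1Dist_picardMap_le (ζ := ζ) hη hp hq hξ hy.1 hy'.1 hs)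
    refine Finset.sum_congr rfl fun k _ => ?_
    rw [hy.2 k s hs, hy'.2 k s hs]
    rfl
  have hbound := fun n => le_pow_div_factorial_of_le_integral (f := fun _ => l1Dist y y')
    (picardConst_nonneg hη hp hq) (fun _ s hs => hD.intervalIntegrable hs)
    (fun s hs => (le_abs_self _).trans (hC s hs)) (fun _ s hs => hstep s hs.1) n t ⟨ht, le_rfl⟩
  have hlim := (FloorSemiring.tendsto_pow_div_factorial_atTop
    (picardConst η p q * t)).const_mul C
  rw [mul_zero] at hlim
  have h0 : l1Dist y y' t ≤ 0 := ge_of_tendsto' hlim hbound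
  exact sub_eq_zero.1 (abs_nonpos_iff.1 ((abs_sub_le_l1Dist y y' k t).trans h0))

theorem exists_isSolA1 (hη : ∀ k, 0 ≤ η k) (hp : ∀ j k, 0 ≤ p j k) (hq : ∀ k j, 0 ≤ q k j)
    (hξ : ∀ j, Cadlag (ξ j)) (hζ : ∀ k, Cadlag (ζ k)) :
    ∃ y, IsSolA1 η p q ξ ζ y := by
  set L := picardConst η p q
  have hL : 0 ≤ L := picardConst_nonneg hη hp hq
  obtain ⟨Y, hzero, hsucc⟩ : ∃ Y : ℕ → Fin K → ℝ → ℝ,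
      Y 0 = 0 ∧ ∀ n, Y (n + 1) = picardMap η p q ξ ζ (Y n) :=
    ⟨fun n => (picardMap η p q ξ ζ)^[n] 0, rfl, fun n => Function.iterate_succ_apply' _ _ _⟩
  have hY : ∀ n k, Cadlag (Y n k) := by
    intro n
    induction n with
    | zero => rw [hzero]; exact fun k => Cadlag.const 0
    | succ n ih => rw [hsucc]; exact Cadlag.picardMap hξ hζ ih
  have hD : ∀ n, Cadlag (l1Dist (Y (n + 1)) (Y n)) := fun n => Cadlag.l1Dist (hY _) (hY _)
  have hstep : ∀ n s, 0 ≤ s → l1Dist (Y (n + 1 + 1)) (Y (n + 1)) s ≤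
      L * ∫ r in (0:ℝ)..s, l1Dist (Y (n + 1)) (Y n) r := by
    intro n s hs
    have h := l1Dist_picardMap_le (ζ := ζ) hη hp hq hξ (hY (n + 1)) (hY n) hs
    rwa [← hsucc, ← hsucc] at h
  let z : Fin K → ℝ → ℝ := fun k t => ∑' n, (Y (n + 1) k t - Y n k t)
  have hunif : ∀ k T, TendstoUniformlyOn (fun n => Y n k) (z k) atTop (Icc 0 T) := by
    intro k T
    obtain ⟨C, hC⟩ := (hD 0).exists_bound T
    have hbound := le_pow_div_factorial_of_le_integral (f := fun n => l1Dist (Y (n + 1)) (Y n))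
      hL (fun n s hs => (hD n).intervalIntegrable hs)
      (fun s hs => (le_abs_self _).trans (hC s hs)) (fun n s hs => hstep n s hs.1)
    have hsummable : Summable fun n : ℕ => C * ((L * T) ^ n / n.factorial) :=
      (Real.summable_pow_div_factorial (L * T)).mul_left C
    have hsum := tendstoUniformlyOn_tsum_nat (f := fun n t => Y (n + 1) k t - Y n k t)
      (s := Icc 0 T) hsummable fun n t ht => by
        have hC0 : 0 ≤ C := (abs_nonneg _).trans (hC t ht)
        have ht0 : 0 ≤ t := ht.1
        refine (abs_sub_le_l1Dist _ _ k t).trans ((hbound n t ht).trans ?_)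
        gcongr
        exact ht.2
    refine hsum.congr (Eventually.of_forall fun n t _ => ?_)
    change ∑ i ∈ Finset.range n, (Y (i + 1) k t - Y i k t) = Y n k t
    rw [Finset.sum_range_sub (fun i => Y i k t)]
    simp [hzero]
  have hz : ∀ k, Cadlag (z k) := fun k =>
    Cadlag.of_tendstoUniformlyOn (fun n => hY n k) (hunif k)
  refine ⟨z, hz, fun k t ht => ?_⟩
  change z k t = picardMap η p q ξ ζ z k t
  have hpt : Tendsto (fun n => Y n k t) atTop (nhds (z k t)) :=
    (hunif k t).tendsto_at ⟨ht, le_rfl⟩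
  refine tendsto_nhds_unique ((tendsto_add_atTop_iff_nat 1).2 hpt) ?_
  have hint : Tendsto (fun n => L * ∫ s in (0:ℝ)..t, l1Dist (Y n) z s) atTop (nhds 0) := by
    suffices h : Tendsto (fun n => ∫ s in (0:ℝ)..t, l1Dist (Y n) z s) atTop
        (nhds (∫ _ in (0:ℝ)..t, (0 : ℝ))) by
      simpa using h.const_mul L
    have hclose : ∀ᶠ n in atTop, ∀ k, ∀ s ∈ Icc 0 t, dist (z k s) (Y n k s) < 1 :=
      eventually_all.2 fun k => Metric.tendstoUniformlyOn_iff.1 (hunif k t) 1 one_pos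
    refine intervalIntegral.tendsto_integral_filter_of_dominated_convergence (fun _ => (K : ℝ))
      (Eventually.of_forall fun n => ?_) (hclose.mono fun n hn => ?_) (by simp) ?_
    · exact ((Cadlag.l1Dist (hY n) hz).intervalIntegrable ht).def'.aestronglyMeasurable
    · refine Eventually.of_forall fun s hs => ?_
      rw [uIoc_of_le ht] at hs
      rw [Real.norm_of_nonneg (l1Dist_nonneg _ _ _)]
      refine (Finset.sum_le_card_nsmul _ _ 1 fun k _ => ?_).trans_eq (by simp)
      rw [← Real.dist_eq, dist_comm]
      exact (hn k s (Ioc_subset_Icc_self hs)).le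
    · refine Eventually.of_forall fun s hs => ?_
      rw [uIoc_of_le ht] at hs
      have h : Tendsto (fun n => ∑ k, |Y n k s - z k s|) atTop (nhds (∑ _ : Fin K, (0 : ℝ))) :=
        tendsto_finsetSum _ fun k _ => tendsto_iff_dist_tendsto_zero.1
          ((hunif k t).tendsto_at (Ioc_subset_Icc_self hs))
      simpa [l1Dist] using h
  refine tendsto_iff_dist_tendsto_zero.2 (squeeze_zero (fun _ => dist_nonneg) (fun n => ?_) hint)
  rw [hsucc, Real.dist_eq]
  exact (abs_sub_le_l1Dist _ _ k t).trans (l1Dist_picardMap_le hη hp hq hξ (hY n) hz ht)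

end FixedPoint

/-- Lemma A.1: for each càdlàg input `(ξ, ζ) ∈ D^{J+K}` there exists a unique càdlàg
`y ∈ D^K` satisfying equation (A.1) (uniqueness in the sense of agreement on `[0,∞)`). -/
theorem stmt0
    (J K : ℕ) (hJ : 0 < J) (hK : 0 < K)
    (μ : Fin J → ℝ) (hμ : ∀ j, 0 < μ j)
    (η : Fin K → ℝ) (hη : ∀ k, 0 < η k)
    (p : Fin J → Fin K → ℝ) (hp : ∀ j k, 0 ≤ p j k) (hprow : ∀ j, ∑ k, p j k = 1)
    (q : Fin K → Fin J → ℝ) (hq : ∀ k j, 0 ≤ q k j) (hqrow : ∀ k, ∑ j, q k j = 1)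
    (ξ : Fin J → ℝ → ℝ) (hξ : ∀ j, Cadlag (ξ j))
    (ζ : Fin K → ℝ → ℝ) (hζ : ∀ k, Cadlag (ζ k)) :
    (∃ y : Fin K → ℝ → ℝ, IsSolA1 η p q ξ ζ y) ∧
    (∀ y y' : Fin K → ℝ → ℝ, IsSolA1 η p q ξ ζ y → IsSolA1 η p q ξ ζ y' →
      ∀ k, ∀ t : ℝ, 0 ≤ t → y k t = y' k t) := by
  have hη' := fun k => (hη k).le
  exact ⟨exists_isSolA1 hη' hp hq hξ hζ, fun y y' hy hy' k t ht =>
    isSolA1_unique hη' hp hq hξ hy hy' k ht⟩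
end

section
/- Let (ξ, ζ), (ξ̃, ζ̃) ∈ D^{J+K} and let y, ỹ ∈ D^K be the respective unique solutions of equation (A.1) for these inputs. Then for every T > 0, max_{k∈[K]} sup_{t∈[0,T]} |y_k(t) − ỹ_k(t)| ≤ 2J · e^{2ηJKT} · max( max_{j∈[J]} ‖ξ_j − ξ̃_j‖_T , max_{k∈[K]} ‖ζ_k − ζ̃_k‖_T ). In particular, if (ξ^n, ζ^n) → (ξ, ζ) uniformly on every compact interval, then the corresponding solutions y^n of (A.1) converge to y uniformly on every compact interval. -/
open MeasureTheory Set Filter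

/-- A right-continuous real function is Borel measurable. -/
theorem measurable_of_continuousWithinAt_Ici {f : ℝ → ℝ}
    (hf : ∀ t, ContinuousWithinAt f (Ici t) t) : Measurable f := by
  let a : ℕ → ℝ → ℝ := fun n t => ((⌊((n : ℝ) + 1) * t⌋ : ℝ) + 1) / ((n : ℝ) + 1)
  have ha : ∀ n, Measurable fun t => f (a n t) := fun n =>
    (Measurable.of_discrete (f := fun m : ℤ => f (((m : ℝ) + 1) / ((n : ℝ) + 1)))).comp
      (Int.measurable_floor.comp (measurable_const_mul ((n : ℝ) + 1)))
  refine measurable_of_tendsto_metrizable ha (tendsto_pi_nhds.2 fun t => ?_)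
  have hlow : ∀ n, t ≤ a n t := fun n => by
    rw [le_div_iff₀ (by positivity), mul_comm]
    exact (Int.lt_floor_add_one _).le
  have hupp : ∀ n, a n t ≤ t + 1 / ((n : ℝ) + 1) := fun n => by
    have hn : (0 : ℝ) < n + 1 := by positivity
    rw [div_le_iff₀ hn, add_mul t, one_div, inv_mul_cancel₀ hn.ne', mul_comm t]
    gcongr
    exact Int.floor_le _
  have hlim : Tendsto (fun n => a n t) atTop (nhds t) := by
    refine tendsto_of_tendsto_of_tendsto_of_le_of_le tendsto_const_nhds ?_ hlow hupp
    simpa using (tendsto_one_div_add_atTop_nhds_zero_nat (𝕜 := ℝ)).const_add t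
  exact (hf t).tendsto.comp
    (tendsto_nhdsWithin_iff.2 ⟨hlim, Eventually.of_forall hlow⟩)

theorem Cadlag.aemeasurable {x : ℝ → ℝ} (hx : Cadlag x) :
    AEMeasurable x (volume.restrict (Ici 0)) := by
  have hm : Measurable fun t => x (max t 0) := by
    refine measurable_of_continuousWithinAt_Ici fun t => ?_
    refine ContinuousWithinAt.comp (t := Ici (max t 0)) (hx.1 _ (le_max_right t 0))
      (by fun_prop) fun s hs => mem_Ici.2 (max_le_max_right 0 hs)
  refine ⟨_, hm, ?_⟩
  filter_upwards [ae_restrict_mem measurableSet_Ici] with t ht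
  rw [max_eq_left ht]

theorem Cadlag.exists_bound_s3 {x : ℝ → ℝ} (hx : Cadlag x) (T : ℝ) :
    ∃ M, ∀ t ∈ Icc 0 T, |x t| ≤ M := by
  refine (isCompact_Icc (a := (0 : ℝ)) (b := T)).induction_on
    (p := fun s => ∃ M, ∀ t ∈ s, |x t| ≤ M) ⟨0, by simp⟩
    (fun s t hst ⟨M, hM⟩ => ⟨M, fun u hu => hM u (hst hu)⟩) ?_ ?_
  · rintro s t ⟨M, hM⟩ ⟨N, hN⟩
    exact ⟨max M N, fun u hu => hu.elim (fun h => (hM u h).trans (le_max_left _ _))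
      fun h => (hN u h).trans (le_max_right _ _)⟩
  · intro t ht
    have hlocal : ∀ {F : Filter ℝ} {L : ℝ}, Tendsto x F (nhds L) →
        ∀ᶠ u in F, |x u| ≤ |L| + 1 := fun h =>
      (h.abs.eventually (gt_mem_nhds (lt_add_one _))).mono fun _ hu => hu.le
    have hright := hlocal (hx.1 t ht.1)
    rcases ht.1.eq_or_lt with h0 | h0
    · refine ⟨_, nhdsWithin_mono t (fun u hu => ?_) hright, _, fun u hu => hu⟩
      exact h0 ▸ hu.1
    · obtain ⟨L, hL⟩ := hx.2 t h0
      have hleft := hlocal hL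
      refine ⟨{u | |x u| ≤ max (|x t| + 1) (|L| + 1)}, mem_nhdsWithin_of_mem_nhds ?_,
        _, fun u hu => hu⟩
      rw [← nhdsLT_sup_nhdsGE]
      exact ⟨hleft.mono fun u hu => hu.trans (le_max_right _ _),
        hright.mono fun u hu => hu.trans (le_max_left _ _)⟩

theorem integrableOn_Icc_of_bound {f : ℝ → ℝ} {T M : ℝ}
    (hf : AEMeasurable f (volume.restrict (Ici 0))) (hM : ∀ t ∈ Icc 0 T, |f t| ≤ M) :
    IntegrableOn f (Icc 0 T) := by
  refine IntegrableOn.of_bound measure_Icc_lt_top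
    (hf.mono_measure (Measure.restrict_mono Icc_subset_Ici_self le_rfl)).aestronglyMeasurable M ?_
  filter_upwards [ae_restrict_mem measurableSet_Icc] with t ht using hM t ht

theorem Cadlag.integrableOn {x : ℝ → ℝ} (hx : Cadlag x) (T : ℝ) :
    IntegrableOn x (Icc 0 T) :=
  let ⟨_, hM⟩ := hx.exists_bound_s3 T
  integrableOn_Icc_of_bound hx.aemeasurable hM

/-- Integral form of Grönwall's inequality for right-continuous functions. -/
theorem le_mul_exp_of_le_add_mul_integral {g : ℝ → ℝ} {T C L : ℝ} (hL : 0 < L)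
    (hg0 : ∀ t, 0 ≤ g t) (hm : AEMeasurable g (volume.restrict (Ici 0)))
    (hr : ∀ t, 0 ≤ t → ContinuousWithinAt g (Ici t) t) (hint : IntegrableOn g (Icc 0 T))
    (hle : ∀ t ∈ Icc 0 T, g t ≤ C + L * ∫ s in (0 : ℝ)..t, g s) :
    ∀ t ∈ Icc 0 T, g t ≤ C * Real.exp (L * t) := by
  intro t ht
  have hT : 0 ≤ T := ht.1.trans ht.2
  have hnonneg : ∀ u, 0 ≤ u → 0 ≤ ∫ s in (0 : ℝ)..u, g s := fun u hu =>
    intervalIntegral.integral_nonneg hu fun s _ => hg0 s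
  have hgron := norm_le_gronwallBound_of_norm_deriv_right_le
    (f := fun u => ∫ s in (0 : ℝ)..u, g s) (f' := g) (δ := 0) (K := L) (ε := C)
    (a := 0) (b := T) ?_ ?_ (by simp) ?_ t ht
  · rw [gronwallBound_of_K_ne_0 hL.ne', Real.norm_of_nonneg (hnonneg t ht.1)] at hgron
    refine (hle t ht).trans ?_
    have := mul_le_mul_of_nonneg_left hgron hL.le
    have hcancel : L * (0 * Real.exp (L * (t - 0)) + C / L * (Real.exp (L * (t - 0)) - 1))
        = C * Real.exp (L * t) - C := by
      field_simp
      ring_nf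
    linarith
  · rw [← uIcc_of_le hT] at hint ⊢
    exact intervalIntegral.continuousOn_primitive_interval hint
  · intro u hu
    refine intervalIntegral.integral_hasDerivWithinAt_right (t := Ioi u) ?_
      ⟨Ioi u, self_mem_nhdsWithin, ?_⟩ ((hr u hu.1).mono Ioi_subset_Ici_self)
    · rw [intervalIntegrable_iff_integrableOn_Icc_of_le hu.1]
      exact hint.mono_set (Icc_subset_Icc_right hu.2.le)
    · exact (hm.mono_measure (Measure.restrict_mono
        (fun v hv => hu.1.trans (le_of_lt hv)) le_rfl)).aestronglyMeasurable
  · intro u hu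
    rw [Real.norm_of_nonneg (hg0 u), Real.norm_of_nonneg (hnonneg u hu.1), add_comm]
    exact hle u ⟨hu.1, hu.2.le⟩

theorem psi_le_psi_add {x x' : ℝ → ℝ} {t d M : ℝ} (ht : 0 ≤ t)
    (hM : ∀ s ∈ Icc 0 t, |x' s| ≤ M) (hd : ∀ s ∈ Icc 0 t, |x s - x' s| ≤ d) :
    psi x t ≤ psi x' t + d := by
  refine csSup_le ((nonempty_Icc.2 ht).image _) ?_
  rintro _ ⟨s, hs, rfl⟩
  have hbdd : BddAbove ((fun s => max (-x' s) 0) '' Icc 0 t) := by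
    refine ⟨M, ?_⟩
    rintro _ ⟨u, hu, rfl⟩
    exact max_le ((neg_le_abs _).trans (hM u hu)) ((abs_nonneg _).trans (hM u hu))
  have hs' : max (-x' s) 0 ≤ psi x' t := le_csSup hbdd ⟨s, hs, rfl⟩
  have hds := abs_le.1 (hd s hs)
  refine max_le ?_ ?_
  · linarith [le_max_left (-x' s) 0]
  · linarith [le_max_right (-x' s) 0]

theorem abs_psi_sub_psi_le_s3 {x x' : ℝ → ℝ} {t d M M' : ℝ} (ht : 0 ≤ t)
    (hM : ∀ s ∈ Icc 0 t, |x s| ≤ M) (hM' : ∀ s ∈ Icc 0 t, |x' s| ≤ M')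
    (hd : ∀ s ∈ Icc 0 t, |x s - x' s| ≤ d) : |psi x t - psi x' t| ≤ d := by
  have h₁ := psi_le_psi_add ht hM' hd
  have h₂ := psi_le_psi_add ht hM fun s hs => (abs_sub_comm _ _).trans_le (hd s hs)
  exact abs_le.2 ⟨by linarith, by linarith⟩

theorem abs_le_supNorm {x : ℝ → ℝ} {T M t : ℝ} (hM : ∀ s ∈ Icc 0 T, |x s| ≤ M)
    (ht : t ∈ Icc 0 T) : |x t| ≤ supNorm x T :=
  le_csSup ⟨M, by rintro _ ⟨s, hs, rfl⟩; exact hM s hs⟩ ⟨t, ht, rfl⟩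

theorem supNorm_le {x : ℝ → ℝ} {T M : ℝ} (hT : 0 ≤ T) (hM : ∀ s ∈ Icc 0 T, |x s| ≤ M) :
    supNorm x T ≤ M :=
  csSup_le ((nonempty_Icc.2 hT).image _) (by rintro _ ⟨s, hs, rfl⟩; exact hM s hs)

/-- The argument of the reflection map in (A.1) is bounded on compacts when `ξ` is. -/
theorem exists_bound_add_sum_integral {K : ℕ} {T M : ℝ} {x : ℝ → ℝ} {c : Fin K → ℝ}
    {y : Fin K → ℝ → ℝ} (hT : 0 ≤ T) (hM : ∀ t ∈ Icc 0 T, |x t| ≤ M) (hy : ∀ k, Cadlag (y k)) :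
    ∃ N, ∀ t ∈ Icc 0 T, |x t + ∑ l, c l * ∫ s in (0 : ℝ)..t, y l s| ≤ N := by
  have hcont : ContinuousOn (fun t => ∑ l, c l * ∫ s in (0 : ℝ)..t, y l s) (Icc 0 T) := by
    refine continuousOn_finsetSum _ fun l _ => continuousOn_const.mul ?_
    have h := (hy l).integrableOn T
    rw [← uIcc_of_le hT] at h ⊢
    exact intervalIntegral.continuousOn_primitive_interval h
  obtain ⟨N, hN⟩ := isCompact_Icc.exists_bound_of_continuousOn hcont
  exact ⟨M + N, fun t ht => (abs_add_le _ _).trans (add_le_add (hM t ht) (hN t ht))⟩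

/-- Pointwise stability estimate for (A.1) under inputs that are `d`-close on `[0,T]`. -/
theorem IsSolA1.abs_sub_le {J K : ℕ} (hJ : 0 < J) {η : Fin K → ℝ} (hη : ∀ k, 0 < η k)
    {p : Fin J → Fin K → ℝ} (hp : ∀ j k, 0 ≤ p j k) (hprow : ∀ j, ∑ k, p j k = 1)
    {q : Fin K → Fin J → ℝ} (hq : ∀ k j, 0 ≤ q k j) (hqrow : ∀ k, ∑ j, q k j = 1)
    {ξ ξ' : Fin J → ℝ → ℝ} {ζ ζ' y y' : Fin K → ℝ → ℝ}
    (hy : IsSolA1 η p q ξ ζ y) (hy' : IsSolA1 η p q ξ' ζ' y') {T d : ℝ}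
    (hξ : ∀ j, ∃ M, ∀ t ∈ Icc 0 T, |ξ j t| ≤ M) (hξ' : ∀ j, ∃ M, ∀ t ∈ Icc 0 T, |ξ' j t| ≤ M)
    (hdξ : ∀ j, ∀ t ∈ Icc 0 T, |ξ j t - ξ' j t| ≤ d)
    (hdζ : ∀ k, ∀ t ∈ Icc 0 T, |ζ k t - ζ' k t| ≤ d) (k : Fin K) :
    ∀ t ∈ Icc 0 T, |y k t - y' k t| ≤
      2 * J * Real.exp (2 * (⨆ k', η k') * J * K * T) * d := by
  set H := ⨆ k', η k' with hH
  have hηH : ∀ l, η l ≤ H := fun l => le_ciSup (finite_range η).bddAbove l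
  have hH0 : 0 < H := (hη k).trans_le (hηH k)
  have hJ1 : (1 : ℝ) ≤ J := by exact_mod_cast hJ
  have hK1 : (1 : ℝ) ≤ K := by exact_mod_cast (Nat.zero_le _).trans_lt k.isLt
  have hp1 : ∀ j k, p j k ≤ 1 := fun j k => by
    rw [← hprow j]
    exact Finset.single_le_sum (fun l _ => hp j l) (Finset.mem_univ k)
  let g : ℝ → ℝ := fun t => ‖fun l => y l t - y' l t‖
  have hg0 : ∀ t, 0 ≤ g t := fun t => norm_nonneg _
  have hyg : ∀ l t, |y l t - y' l t| ≤ g t := fun l t =>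
    norm_le_pi_norm (fun l => y l t - y' l t) l
  have hgm : AEMeasurable g (volume.restrict (Ici 0)) :=
    (aemeasurable_pi_lambda _ fun l => (hy.1 l).aemeasurable.sub (hy'.1 l).aemeasurable).norm
  have hgr : ∀ t, 0 ≤ t → ContinuousWithinAt g (Ici t) t := fun t ht =>
    (continuousWithinAt_pi.2 fun l => ((hy.1 l).1 t ht).sub ((hy'.1 l).1 t ht)).norm
  have hgint : IntegrableOn g (Icc 0 T) := by
    choose M hM using fun l => (hy.1 l).exists_bound_s3 T
    choose M' hM' using fun l => (hy'.1 l).exists_bound_s3 T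
    refine integrableOn_Icc_of_bound (M := ∑ l, (|M l| + |M' l|)) hgm fun t ht => ?_
    rw [abs_of_nonneg (hg0 t)]
    refine (pi_norm_le_iff_of_nonneg (by positivity)).2 fun l => ?_
    refine le_trans ?_ (Finset.single_le_sum (f := fun l => |M l| + |M' l|)
      (fun i _ => by positivity) (Finset.mem_univ l))
    exact (abs_sub _ _).trans (add_le_add ((hM l t ht).trans (le_abs_self _))
      ((hM' l t ht).trans (le_abs_self _)))
  intro t ht
  have hT : 0 ≤ T := ht.1.trans ht.2
  have hd0 : 0 ≤ d := (abs_nonneg _).trans (hdζ k t ht)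
  let G : ℝ → ℝ := fun u => ∫ s in (0 : ℝ)..u, g s
  have hgii : ∀ u ∈ Icc 0 T, IntervalIntegrable g volume 0 u := fun u hu =>
    (intervalIntegrable_iff_integrableOn_Icc_of_le hu.1).2
      (hgint.mono_set (Icc_subset_Icc_right hu.2))
  have hyii : ∀ {z : ℝ → ℝ}, Cadlag z → ∀ u ∈ Icc 0 T, IntervalIntegrable z volume 0 u :=
    fun hz u hu => (intervalIntegrable_iff_integrableOn_Icc_of_le hu.1).2 (hz.integrableOn u)
  have hG0 : ∀ u ∈ Icc 0 T, 0 ≤ G u := fun u hu =>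
    intervalIntegral.integral_nonneg hu.1 fun s _ => hg0 s
  have hGmono : ∀ u ∈ Icc 0 T, ∀ r ∈ Icc 0 u, G r ≤ G u := fun u hu r hr =>
    intervalIntegral.integral_mono_interval le_rfl hr.1 hr.2
      (Eventually.of_forall hg0) (hgii u hu)
  have hIG : ∀ l, ∀ u ∈ Icc 0 T,
      |(∫ s in (0 : ℝ)..u, y l s) - ∫ s in (0 : ℝ)..u, y' l s| ≤ G u := fun l u hu => by
    rw [← intervalIntegral.integral_sub (hyii (hy.1 l) u hu) (hyii (hy'.1 l) u hu)]
    exact intervalIntegral.norm_integral_le_of_norm_le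
      (f := fun s => y l s - y' l s) hu.1 (Eventually.of_forall fun s _ => hyg l s) (hgii u hu)
  have hψ : ∀ j, ∀ u ∈ Icc 0 T,
      |psi (fun r => ξ j r + ∑ l, q l j * η l * (∫ s in (0:ℝ)..r, y l s)) u -
        psi (fun r => ξ' j r + ∑ l, q l j * η l * (∫ s in (0:ℝ)..r, y' l s)) u| ≤
      d + (∑ l, q l j) * (H * G u) := fun j u hu => by
    obtain ⟨M, hM⟩ := hξ j
    obtain ⟨M', hM'⟩ := hξ' j
    obtain ⟨N, hN⟩ := exists_bound_add_sum_integral (c := fun l => q l j * η l) hT hM hy.1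
    obtain ⟨N', hN'⟩ := exists_bound_add_sum_integral (c := fun l => q l j * η l) hT hM' hy'.1
    refine abs_psi_sub_psi_le_s3 hu.1 (fun s hs => hN s ⟨hs.1, hs.2.trans hu.2⟩)
      (fun s hs => hN' s ⟨hs.1, hs.2.trans hu.2⟩) fun r hr => ?_
    have hrT : r ∈ Icc 0 T := ⟨hr.1, hr.2.trans hu.2⟩
    rw [add_sub_add_comm, ← Finset.sum_sub_distrib, Finset.sum_mul]
    refine (abs_add_le _ _).trans (add_le_add (hdξ j r hrT) ?_)
    refine (Finset.abs_sum_le_sum_abs _ _).trans (Finset.sum_le_sum fun l _ => ?_)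
    rw [← mul_sub, abs_mul, abs_of_nonneg (mul_nonneg (hq l j) (hη l).le), mul_assoc]
    refine mul_le_mul_of_nonneg_left ?_ (hq l j)
    exact mul_le_mul (hηH l) ((hIG l r hrT).trans (hGmono u hu r hr)) (abs_nonneg _) hH0.le
  have hqsum : ∑ j, ∑ l, q l j = K := by
    rw [Finset.sum_comm]
    simp [hqrow]
  have hcomp : ∀ k, ∀ u ∈ Icc 0 T,
      |y k u - y' k u| ≤ 2 * J * d + 2 * H * J * K * G u := fun k u hu => by
    have hGu := mul_nonneg hH0.le (hG0 u hu)
    have hsum : |∑ j, p j k *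
          (psi (fun r => ξ j r + ∑ l, q l j * η l * (∫ s in (0:ℝ)..r, y l s)) u -
          psi (fun r => ξ' j r + ∑ l, q l j * η l * (∫ s in (0:ℝ)..r, y' l s)) u)| ≤
        J * d + K * (H * G u) := by
      calc _ ≤ ∑ j, (d + (∑ l, q l j) * (H * G u)) := by
            refine (Finset.abs_sum_le_sum_abs _ _).trans (Finset.sum_le_sum fun j _ => ?_)
            rw [abs_mul, abs_of_nonneg (hp j k)]
            exact (mul_le_of_le_one_left (abs_nonneg _) (hp1 j k)).trans (hψ j u hu)
        _ = J * d + K * (H * G u) := by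
            rw [Finset.sum_add_distrib, ← Finset.sum_mul, hqsum]
            simp
    have hlin : |η k * ((∫ s in (0 : ℝ)..u, y k s) - ∫ s in (0 : ℝ)..u, y' k s)| ≤ H * G u := by
      rw [abs_mul, abs_of_pos (hη k)]
      exact mul_le_mul (hηH k) (hIG k u hu) (abs_nonneg _) hH0.le
    have hζu := hdζ k u hu
    have hdecomp : y k u - y' k u = (ζ k u - ζ' k u)
        - η k * ((∫ s in (0 : ℝ)..u, y k s) - ∫ s in (0 : ℝ)..u, y' k s)
        - ∑ j, p j k *
          (psi (fun r => ξ j r + ∑ l, q l j * η l * (∫ s in (0:ℝ)..r, y l s)) u -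
          psi (fun r => ξ' j r + ∑ l, q l j * η l * (∫ s in (0:ℝ)..r, y' l s)) u) := by
      rw [hy.2 k u hu.1, hy'.2 k u hu.1]
      simp only [mul_sub, Finset.sum_sub_distrib]
      ring
    have htri : |y k u - y' k u| ≤ d + H * G u + (J * d + K * (H * G u)) := by
      rw [hdecomp]
      exact (abs_sub _ _).trans (add_le_add ((abs_sub _ _).trans (add_le_add hζu hlin)) hsum)
    have hJd : d + J * d ≤ 2 * J * d := by nlinarith
    have hJK : (1 + K : ℝ) ≤ 2 * J * K := by nlinarith
    nlinarith [mul_le_mul_of_nonneg_right hJK hGu]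
  have hgG : ∀ u ∈ Icc 0 T, g u ≤ 2 * J * d + 2 * H * J * K * G u := fun u hu => by
    have hGu := hG0 u hu
    exact (pi_norm_le_iff_of_nonneg (by positivity)).2 fun l => hcomp l u hu
  have hgron := le_mul_exp_of_le_add_mul_integral (by positivity) hg0 hgm hgr hgint hgG t ht
  refine (hyg k t).trans (hgron.trans ?_)
  rw [mul_right_comm]
  gcongr
  exact ht.2

/-- Lipschitz continuity of the solution map of (A.1): the solutions for two inputs
satisfy `max_k ‖y_k − ỹ_k‖_T ≤ 2J e^{2ηJKT} max(max_j ‖ξ_j − ξ̃_j‖_T, max_k ‖ζ_k − ζ̃_k‖_T)`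
for every `T > 0`; in particular, uniform-on-compacts convergence of inputs implies
uniform-on-compacts convergence of the corresponding solutions. -/
theorem stmt3
    (J K : ℕ) (hJ : 0 < J) (hK : 0 < K)
    (μ : Fin J → ℝ) (hμ : ∀ j, 0 < μ j)
    (η : Fin K → ℝ) (hη : ∀ k, 0 < η k)
    (p : Fin J → Fin K → ℝ) (hp : ∀ j k, 0 ≤ p j k) (hprow : ∀ j, ∑ k, p j k = 1)
    (q : Fin K → Fin J → ℝ) (hq : ∀ k j, 0 ≤ q k j) (hqrow : ∀ k, ∑ j, q k j = 1)
    (ξ ξ' : Fin J → ℝ → ℝ) (hξ : ∀ j, Cadlag (ξ j)) (hξ' : ∀ j, Cadlag (ξ' j))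
    (ζ ζ' : Fin K → ℝ → ℝ) (hζ : ∀ k, Cadlag (ζ k)) (hζ' : ∀ k, Cadlag (ζ' k))
    (y y' : Fin K → ℝ → ℝ)
    (hy : IsSolA1 η p q ξ ζ y) (hy' : IsSolA1 η p q ξ' ζ' y') :
    (∀ T : ℝ, 0 < T → ∀ k,
      supNorm (fun t => y k t - y' k t) T ≤
        2 * J * Real.exp (2 * (⨆ k', η k') * J * K * T) *
          max (⨆ j, supNorm (fun t => ξ j t - ξ' j t) T)
              (⨆ k', supNorm (fun t => ζ k' t - ζ' k' t) T)) ∧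
    (∀ (ξs : ℕ → Fin J → ℝ → ℝ) (ζs : ℕ → Fin K → ℝ → ℝ) (ys : ℕ → Fin K → ℝ → ℝ),
      (∀ n, IsSolA1 η p q (ξs n) (ζs n) (ys n)) →
      (∀ T : ℝ, 0 < T → ∀ j,
        TendstoUniformlyOn (fun n => ξs n j) (ξ j) Filter.atTop (Set.Icc 0 T)) →
      (∀ T : ℝ, 0 < T → ∀ k,
        TendstoUniformlyOn (fun n => ζs n k) (ζ k) Filter.atTop (Set.Icc 0 T)) →
      ∀ T : ℝ, 0 < T → ∀ k,
        TendstoUniformlyOn (fun n => ys n k) (y k) Filter.atTop (Set.Icc 0 T)) := by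
  constructor
  · intro T hT k
    refine supNorm_le hT.le (hy.abs_sub_le hJ hη hp hprow hq hqrow hy'
      (fun j => (hξ j).exists_bound_s3 T) (fun j => (hξ' j).exists_bound_s3 T) ?_ ?_ k)
    · intro j t ht
      obtain ⟨M, hM⟩ := (hξ j).exists_bound_s3 T
      obtain ⟨M', hM'⟩ := (hξ' j).exists_bound_s3 T
      refine (abs_le_supNorm (x := fun t => ξ j t - ξ' j t) (M := M + M')
        (fun s hs => (abs_sub _ _).trans (add_le_add (hM s hs) (hM' s hs))) ht).trans ?_
      exact (le_ciSup (f := fun j => supNorm (fun t => ξ j t - ξ' j t) T)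
        (finite_range _).bddAbove j).trans (le_max_left _ _)
    · intro k t ht
      obtain ⟨M, hM⟩ := (hζ k).exists_bound_s3 T
      obtain ⟨M', hM'⟩ := (hζ' k).exists_bound_s3 T
      refine (abs_le_supNorm (x := fun t => ζ k t - ζ' k t) (M := M + M')
        (fun s hs => (abs_sub _ _).trans (add_le_add (hM s hs) (hM' s hs))) ht).trans ?_
      exact (le_ciSup (f := fun k => supNorm (fun t => ζ k t - ζ' k t) T)
        (finite_range _).bddAbove k).trans (le_max_right _ _)
  · intro ξs ζs ys hys hξs hζs T hT k
    rw [Metric.tendstoUniformlyOn_iff]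
    intro ε hε
    set A := 2 * J * Real.exp (2 * (⨆ k', η k') * J * K * T)
    have hA : 0 < A := by positivity
    have hd : 0 < ε / (2 * A) := by positivity
    have h₁ := eventually_all.2 fun j => Metric.tendstoUniformlyOn_iff.1 (hξs T hT j) _ hd
    have h₂ := eventually_all.2 fun k => Metric.tendstoUniformlyOn_iff.1 (hζs T hT k) _ hd
    filter_upwards [h₁, h₂] with n hn₁ hn₂ t ht
    refine (hy.abs_sub_le hJ hη hp hprow hq hqrow (hys n) (fun j => (hξ j).exists_bound_s3 T)
      (fun j => ?_) (fun j t ht => (hn₁ j t ht).le) (fun k t ht => (hn₂ k t ht).le)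
      k t ht).trans_lt ?_
    · obtain ⟨M, hM⟩ := (hξ j).exists_bound_s3 T
      refine ⟨M + ε / (2 * A), fun s hs => ?_⟩
      have hclose := abs_lt.1 (Real.dist_eq _ _ ▸ hn₁ j s hs)
      have hMs := abs_le.1 (hM s hs)
      exact abs_le.2 ⟨by linarith, by linarith⟩
    · have : A * (ε / (2 * A)) = ε / 2 := by field_simp
      linarith
end

section
/- Fix (ξ, ζ) ∈ D^{J+K} and T > 0. Define the successive approximation sequence y^0 ≡ 0 and, for n ≥ 1 and k ∈ [K], y_k^n := ζ_k − η_k ∫_0^· y_k^{n−1}(s) ds − Σ_{j=1}^J p_{jk} ψ( ξ_j + Σ_{l=1}^K q_{lj} η_l ∫_0^· y_l^{n−1}(s) ds ). Then the sequence { (y_1^n|_{[0,T]}, …, y_K^n|_{[0,T]}) : n = 0, 1, … } is a Cauchy sequence with respect to the norm ‖y‖_{T,K} := max_{k∈[K]} sup_{t∈[0,T]} |y_k(t)|. -/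
open MeasureTheory Set Filter

/-- A function bounded and a.e. measurable on `[0, T]`. -/
def BddMeasOn (T : ℝ) (f : ℝ → ℝ) : Prop :=
  (∃ C, ∀ t ∈ Set.Icc 0 T, |f t| ≤ C) ∧ AEMeasurable f (volume.restrict (Set.Icc 0 T))

theorem Cadlag.bounded {x : ℝ → ℝ} (hx : Cadlag x) (T : ℝ) :
    ∃ C, ∀ t ∈ Set.Icc 0 T, |x t| ≤ C := by
  have key : ∀ (l : Filter ℝ) (a : ℝ), Tendsto x l (nhds a) → ∀ᶠ s in l, |x s| ≤ |a| + 1 :=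
    fun l a h => (h.abs.eventually_lt_const (lt_add_one |a|)).mono fun _ h => h.le
  refine isCompact_Icc.induction_on (p := fun s => ∃ C, ∀ t ∈ s, |x t| ≤ C) ⟨0, by simp⟩
    (fun s t hst ⟨C, hC⟩ => ⟨C, fun r hr => hC r (hst hr)⟩) ?_ ?_
  · rintro s t ⟨C, hC⟩ ⟨D, hD⟩
    refine ⟨max C D, ?_⟩
    rintro r (hr | hr)
    · exact (hC r hr).trans (le_max_left _ _)
    · exact (hD r hr).trans (le_max_right _ _)
  · intro t ht
    have hR := key _ _ (hx.1 t ht.1)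
    rcases ht.1.eq_or_lt with h0 | h0
    · refine ⟨{s | |x s| ≤ |x t| + 1}, ?_, _, fun s hs => hs⟩
      exact nhdsWithin_mono t (fun s hs => h0 ▸ hs.1) hR
    · obtain ⟨L, hL⟩ := hx.2 t h0
      have hL' := key _ _ hL
      refine ⟨{s | |x s| ≤ max (|x t| + 1) (|L| + 1)}, mem_nhdsWithin_of_mem_nhds ?_, _,
        fun s hs => hs⟩
      rw [← nhdsLT_sup_nhdsGE t]
      exact ⟨hL'.mono fun s hs => hs.trans (le_max_right _ _),
        hR.mono fun s hs => hs.trans (le_max_left _ _)⟩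

theorem measurable_of_continuousWithinAt_Ici_s5 {x : ℝ → ℝ}
    (hx : ∀ t, ContinuousWithinAt x (Set.Ici t) t) : Measurable x := by
  let g : ℕ → ℝ → ℝ := fun n t => ((⌊((n : ℝ) + 1) * t⌋ : ℝ) + 1) / ((n : ℝ) + 1)
  have hle : ∀ n t, t ≤ g n t := fun n t => by
    rw [le_div_iff₀ (by positivity), mul_comm]
    exact (Int.lt_floor_add_one _).le
  have hge : ∀ n t, g n t ≤ t + 1 / ((n : ℝ) + 1) := fun n t => by
    have := Int.floor_le (((n : ℝ) + 1) * t)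
    have h1 : (1 / ((n : ℝ) + 1)) * ((n : ℝ) + 1) = 1 := one_div_mul_cancel (by positivity)
    rw [div_le_iff₀ (by positivity), add_mul t, h1]
    linarith
  refine measurable_of_tendsto_metrizable (f := fun n t => x (g n t)) (fun n => ?_) ?_
  · exact (measurable_from_top (f := fun i : ℤ => x (((i : ℝ) + 1) / ((n : ℝ) + 1)))).comp
      (Int.measurable_floor.comp (measurable_const_mul _))
  · refine tendsto_pi_nhds.2 fun t => (hx t).tendsto.comp ?_
    refine tendsto_nhdsWithin_iff.2 ⟨?_, Eventually.of_forall fun n => hle n t⟩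
    refine tendsto_of_tendsto_of_tendsto_of_le_of_le tendsto_const_nhds ?_ (fun n => hle n t)
      (fun n => hge n t)
    simpa using tendsto_const_nhds.add (tendsto_one_div_add_atTop_nhds_zero_nat (𝕜 := ℝ))

theorem Cadlag.bddMeasOn {x : ℝ → ℝ} (hx : Cadlag x) (T : ℝ) : BddMeasOn T x := by
  refine ⟨hx.bounded T, ?_⟩
  have hm : Measurable fun t => x (max t 0) := by
    refine measurable_of_continuousWithinAt_Ici_s5 fun t => ?_
    refine (hx.1 (max t 0) (le_max_right _ _)).comp (f := fun t : ℝ => max t 0)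
      (by fun_prop) fun s hs => ?_
    exact max_le_max_right 0 (Set.mem_Ici.1 hs)
  refine hm.aemeasurable.congr ?_
  filter_upwards [ae_restrict_mem measurableSet_Icc] with t ht
  rw [max_eq_left ht.1]

namespace BddMeasOn

variable {T : ℝ} {f g : ℝ → ℝ}

theorem add (hf : BddMeasOn T f) (hg : BddMeasOn T g) : BddMeasOn T fun t => f t + g t := by
  obtain ⟨⟨C, hC⟩, hf⟩ := hf
  obtain ⟨⟨D, hD⟩, hg⟩ := hg
  exact ⟨⟨C + D, fun t ht => (abs_add_le _ _).trans (add_le_add (hC t ht) (hD t ht))⟩, hf.add hg⟩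

theorem const_mul (hf : BddMeasOn T f) (c : ℝ) : BddMeasOn T fun t => c * f t := by
  obtain ⟨⟨C, hC⟩, hf⟩ := hf
  refine ⟨⟨|c| * C, fun t ht => ?_⟩, hf.const_mul c⟩
  rw [abs_mul]
  exact mul_le_mul_of_nonneg_left (hC t ht) (abs_nonneg c)

theorem sub (hf : BddMeasOn T f) (hg : BddMeasOn T g) : BddMeasOn T fun t => f t - g t := by
  simpa [sub_eq_add_neg] using hf.add (hg.const_mul (-1))

theorem zero : BddMeasOn T fun _ => 0 := ⟨⟨0, by simp⟩, aemeasurable_const⟩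

theorem sum {ι : Type*} {F : ι → ℝ → ℝ} (s : Finset ι) (hF : ∀ i, BddMeasOn T (F i)) :
    BddMeasOn T fun t => ∑ i ∈ s, F i t := by
  classical
  induction s using Finset.induction_on with
  | empty => simpa using zero
  | insert i s hi ih => simpa [Finset.sum_insert hi] using (hF i).add ih

theorem integrableOn (hf : BddMeasOn T f) : IntegrableOn f (Set.Icc 0 T) := by
  obtain ⟨⟨C, hC⟩, hf⟩ := hf
  refine IntegrableOn.of_bound (by simp) hf.aestronglyMeasurable C ?_
  filter_upwards [ae_restrict_mem measurableSet_Icc] with t ht using hC t ht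

theorem intervalIntegrable (hf : BddMeasOn T f) {t : ℝ} (ht : t ∈ Set.Icc 0 T) :
    IntervalIntegrable f volume 0 t :=
  (hf.integrableOn.mono_set (by
    rw [Set.uIcc_of_le ht.1]; exact Set.Icc_subset_Icc_right ht.2)).intervalIntegrable

theorem integral (hf : BddMeasOn T f) (hT : 0 ≤ T) : BddMeasOn T fun t => ∫ s in (0:ℝ)..t, f s := by
  have h : ContinuousOn (fun t => ∫ s in (0:ℝ)..t, f s) (Set.Icc 0 T) := by
    have := intervalIntegral.continuousOn_primitive_interval (μ := volume) (f := f) (a := 0) (b := T)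
      (by rw [Set.uIcc_of_le hT]; exact hf.integrableOn)
    rwa [Set.uIcc_of_le hT] at this
  exact ⟨isCompact_Icc.exists_bound_of_continuousOn h, h.aemeasurable measurableSet_Icc⟩

theorem bddAbove_psi (hf : BddMeasOn T f) {t : ℝ} (ht : t ≤ T) :
    BddAbove ((fun s => max (-f s) 0) '' Set.Icc 0 t) := by
  obtain ⟨⟨C, hC⟩, -⟩ := hf
  refine ⟨max C 0, ?_⟩
  rintro _ ⟨s, hs, rfl⟩
  exact max_le_max_right 0 ((neg_le_abs _).trans (hC s ⟨hs.1, hs.2.trans ht⟩))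

theorem psi (hf : BddMeasOn T f) : BddMeasOn T (psi f) := by
  have hmono : MonotoneOn (_root_.psi f) (Set.Icc 0 T) := fun a ha b hb hab =>
    csSup_le_csSup (hf.bddAbove_psi hb.2) ((Set.nonempty_Icc.2 ha.1).image _)
      (Set.image_mono (Set.Icc_subset_Icc_right hab))
  refine ⟨⟨_root_.psi f T, fun t ht => ?_⟩,
    aemeasurable_restrict_of_monotoneOn measurableSet_Icc hmono⟩
  have h0 : 0 ≤ _root_.psi f t := Real.sSup_nonneg (by rintro _ ⟨s, -, rfl⟩; exact le_max_right _ _)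
  rw [abs_of_nonneg h0]
  exact hmono ht ⟨ht.1.trans ht.2, le_rfl⟩ ht.2

theorem psi_sub_le (hg : BddMeasOn T g) {t B : ℝ} (ht : t ∈ Set.Icc 0 T)
    (h : ∀ s ∈ Set.Icc 0 t, |f s - g s| ≤ B) : _root_.psi f t - _root_.psi g t ≤ B := by
  rw [sub_le_iff_le_add]
  refine csSup_le ((Set.nonempty_Icc.2 ht.1).image _) ?_
  rintro _ ⟨s, hs, rfl⟩
  have h1 : max (-g s) 0 ≤ _root_.psi g t := le_csSup (hg.bddAbove_psi ht.2) ⟨s, hs, rfl⟩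
  have h2 := abs_le.1 (h s hs)
  have h3 := le_max_left (-g s) 0
  have h4 := le_max_right (-g s) 0
  exact max_le (by linarith) (by linarith)

theorem abs_psi_sub_le (hf : BddMeasOn T f) (hg : BddMeasOn T g) {t B : ℝ} (ht : t ∈ Set.Icc 0 T)
    (h : ∀ s ∈ Set.Icc 0 t, |f s - g s| ≤ B) : |_root_.psi f t - _root_.psi g t| ≤ B :=
  abs_sub_le_iff.2 ⟨hg.psi_sub_le ht h,
    hf.psi_sub_le ht fun s hs => by rw [abs_sub_comm]; exact h s hs⟩

theorem abs_integral_sub_le (hf : BddMeasOn T f) (hg : BddMeasOn T g) {t A L : ℝ} {n : ℕ}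
    (ht : t ∈ Set.Icc 0 T)
    (h : ∀ s ∈ Set.Icc 0 T, |f s - g s| ≤ A * (L ^ n * s ^ n / n.factorial)) :
    |(∫ s in (0:ℝ)..t, f s) - ∫ s in (0:ℝ)..t, g s| ≤
      A * (L ^ n * t ^ (n + 1) / (n + 1).factorial) := by
  rw [← intervalIntegral.integral_sub (hf.intervalIntegrable ht) (hg.intervalIntegrable ht)]
  have h1 : |∫ s in (0:ℝ)..t, (f s - g s)| ≤
      ∫ s in (0:ℝ)..t, A * (L ^ n * s ^ n / n.factorial) := by
    rw [← Real.norm_eq_abs]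
    exact intervalIntegral.norm_integral_le_of_norm_le (g := fun s => A * (L ^ n * s ^ n / n.factorial))
      ht.1 (Eventually.of_forall fun s hs => h s ⟨hs.1.le, hs.2.trans ht.2⟩)
      (Continuous.intervalIntegrable (by fun_prop) _ _)
  refine h1.trans_eq ?_
  simp only [intervalIntegral.integral_const_mul, intervalIntegral.integral_div, integral_pow,
    Nat.factorial_succ]
  push_cast
  field_simp
  simp

end BddMeasOn

/-- Lemma B.1 (Cauchy property): the successive-approximation sequence for (A.1) is
Cauchy on `[0,T]` with respect to the norm `‖y‖_{T,K} = max_k sup_{t∈[0,T]} |y_k t|`. -/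
theorem stmt5
    (J K : ℕ) (hJ : 0 < J) (hK : 0 < K)
    (μ : Fin J → ℝ) (hμ : ∀ j, 0 < μ j)
    (η : Fin K → ℝ) (hη : ∀ k, 0 < η k)
    (p : Fin J → Fin K → ℝ) (hp : ∀ j k, 0 ≤ p j k) (hprow : ∀ j, ∑ k, p j k = 1)
    (q : Fin K → Fin J → ℝ) (hq : ∀ k j, 0 ≤ q k j) (hqrow : ∀ k, ∑ j, q k j = 1)
    (ξ : Fin J → ℝ → ℝ) (hξ : ∀ j, Cadlag (ξ j))
    (ζ : Fin K → ℝ → ℝ) (hζ : ∀ k, Cadlag (ζ k))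
    (T : ℝ) (hT : 0 < T)
    (yseq : ℕ → Fin K → ℝ → ℝ)
    (h0 : ∀ k, ∀ t : ℝ, yseq 0 k t = 0)
    (hrec : ∀ n : ℕ, ∀ k, ∀ t : ℝ,
      yseq (n + 1) k t =
        ζ k t - η k * (∫ s in (0:ℝ)..t, yseq n k s)
          - ∑ j, p j k *
              psi (fun r => ξ j r + ∑ l, q l j * η l * (∫ s in (0:ℝ)..r, yseq n l s)) t) :
    ∀ ε : ℝ, 0 < ε → ∃ N : ℕ, ∀ m n : ℕ, N ≤ m → N ≤ n →
      ∀ k, supNorm (fun t => yseq m k t - yseq n k t) T < ε := by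
  have hy : ∀ n k, BddMeasOn T (yseq n k) := by
    intro n
    induction n with
    | zero => intro k; rw [show yseq 0 k = fun _ => 0 from funext (h0 k)]; exact .zero
    | succ n ih =>
      intro k
      rw [show yseq (n + 1) k = _ from funext (hrec n k)]
      exact (((hζ k).bddMeasOn T).sub (((ih k).integral hT.le).const_mul _)).sub
        (.sum _ fun j => (((hξ j).bddMeasOn T).add
          (.sum _ fun l => ((ih l).integral hT.le).const_mul _)).psi.const_mul _)
  have hx : ∀ n j, BddMeasOn T
      fun r => ξ j r + ∑ l, q l j * η l * (∫ s in (0:ℝ)..r, yseq n l s) := fun n j =>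
    ((hξ j).bddMeasOn T).add (.sum _ fun l => ((hy n l).integral hT.le).const_mul _)
  have hqη : ∀ l j, 0 ≤ q l j * η l := fun l j => mul_nonneg (hq l j) (hη l).le
  let c : Fin K → ℝ := fun k => η k + ∑ j, p j k * ∑ l, q l j * η l
  have hc : ∀ k, 0 ≤ c k := fun k => add_nonneg (hη k).le <| Finset.sum_nonneg fun j _ =>
    mul_nonneg (hp j k) (Finset.sum_nonneg fun l _ => hqη l j)
  let L : ℝ := ∑ k, c k
  have hL : 0 ≤ L := Finset.sum_nonneg fun k _ => hc k
  have hcL : ∀ k, c k ≤ L := fun k =>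
    Finset.single_le_sum (fun k _ => hc k) (Finset.mem_univ k)
  obtain ⟨A, hA0, hA⟩ : ∃ A, 0 ≤ A ∧ ∀ k, ∀ t ∈ Set.Icc 0 T, |yseq 1 k t| ≤ A := by
    choose C hC using fun k => (hy 1 k).1
    refine ⟨∑ k, |C k|, Finset.sum_nonneg fun k _ => abs_nonneg _, fun k t ht => ?_⟩
    exact ((hC k t ht).trans (le_abs_self _)).trans
      (Finset.single_le_sum (f := fun k => |C k|) (fun k _ => abs_nonneg _) (Finset.mem_univ k))
  have hstep : ∀ n k, ∀ t ∈ Set.Icc 0 T,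
      |yseq (n + 1) k t - yseq n k t| ≤ A * (L ^ n * t ^ n / n.factorial) := by
    intro n
    induction n with
    | zero => intro k t ht; simpa [h0] using hA k t ht
    | succ n ih =>
      intro k t ht
      set B : ℝ → ℝ := fun r => A * (L ^ n * r ^ (n + 1) / (n + 1).factorial) with hB
      have hB0 : 0 ≤ B t := by have := ht.1; positivity
      have hI : ∀ l, ∀ r ∈ Set.Icc 0 t, |(∫ s in (0:ℝ)..r, yseq (n + 1) l s) -
          ∫ s in (0:ℝ)..r, yseq n l s| ≤ B t := fun l r hr => by
        refine ((hy (n + 1) l).abs_integral_sub_le (hy n l) ⟨hr.1, hr.2.trans ht.2⟩ (ih l)).trans ?_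
        have h1 := hr.1
        have h2 := hr.2
        simp only [hB]
        gcongr
      have hψ : ∀ j, |psi (fun r => ξ j r + ∑ l, q l j * η l *
            (∫ s in (0:ℝ)..r, yseq (n + 1) l s)) t -
          psi (fun r => ξ j r + ∑ l, q l j * η l * (∫ s in (0:ℝ)..r, yseq n l s)) t| ≤
          (∑ l, q l j * η l) * B t := fun j => by
        refine (hx (n + 1) j).abs_psi_sub_le (hx n j) ht fun r hr => ?_
        rw [add_sub_add_left_eq_sub, ← Finset.sum_sub_distrib, Finset.sum_mul]
        refine (Finset.abs_sum_le_sum_abs _ _).trans (Finset.sum_le_sum fun l _ => ?_)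
        rw [← mul_sub, abs_mul, abs_of_nonneg (hqη l j)]
        exact mul_le_mul_of_nonneg_left (hI l r hr) (hqη l j)
      have hsum : |∑ j, p j k * (psi (fun r => ξ j r + ∑ l, q l j * η l *
            (∫ s in (0:ℝ)..r, yseq (n + 1) l s)) t -
          psi (fun r => ξ j r + ∑ l, q l j * η l * (∫ s in (0:ℝ)..r, yseq n l s)) t)| ≤
          (∑ j, p j k * ∑ l, q l j * η l) * B t := by
        rw [Finset.sum_mul]
        refine (Finset.abs_sum_le_sum_abs _ _).trans (Finset.sum_le_sum fun j _ => ?_)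
        rw [abs_mul, abs_of_nonneg (hp j k), mul_assoc]
        exact mul_le_mul_of_nonneg_left (hψ j) (hp j k)
      have hint : |η k * ((∫ s in (0:ℝ)..t, yseq (n + 1) k s) -
          ∫ s in (0:ℝ)..t, yseq n k s)| ≤ η k * B t := by
        rw [abs_mul, abs_of_pos (hη k)]
        exact mul_le_mul_of_nonneg_left (hI k t ⟨ht.1, le_rfl⟩) (hη k).le
      calc |yseq (n + 1 + 1) k t - yseq (n + 1) k t| ≤ c k * B t := by
            rw [hrec (n + 1), hrec n]
            simp only [mul_sub, Finset.sum_sub_distrib] at hsum hint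
            simp only [c, add_mul]
            rw [abs_le] at *
            constructor <;> linarith [hsum.1, hsum.2, hint.1, hint.2]
        _ ≤ L * B t := mul_le_mul_of_nonneg_right (hcL k) hB0
        _ = _ := by simp only [hB]; ring
  intro ε hε
  let u : ℕ → ℝ := fun n => A * (L ^ n * T ^ n / n.factorial)
  have hu : Summable u := by
    have := (Real.summable_pow_div_factorial (L * T)).mul_left A
    simpa only [mul_pow] using this
  obtain ⟨N, hN⟩ := Metric.cauchySeq_iff.1 hu.hasSum.tendsto_sum_nat.cauchySeq (ε / 2) (half_pos hε)
  have hle : ∀ k, ∀ t ∈ Set.Icc 0 T, ∀ m n, N ≤ m → m ≤ n →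
      |yseq m k t - yseq n k t| ≤ ε / 2 := by
    intro k t ht m n hm hmn
    have h1 := dist_le_Ico_sum_of_dist_le (f := fun n => yseq n k t) (d := u) hmn
      fun {i} _ _ => by
        rw [dist_comm, Real.dist_eq]
        refine (hstep i k t ht).trans ?_
        have h2 := ht.1
        have h3 := ht.2
        simp only [u]
        gcongr
    rw [Finset.sum_Ico_eq_sub _ hmn] at h1
    have h2 := hN n (hm.trans hmn) m hm
    rw [Real.dist_eq] at h1 h2
    exact h1.trans ((le_abs_self _).trans h2.le)
  refine ⟨N, fun m n hm hn k => lt_of_le_of_lt (Real.sSup_le ?_ (half_pos hε).le) (half_lt_self hε)⟩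
  rintro _ ⟨t, ht, rfl⟩
  rcases le_total m n with h | h
  · exact hle k t ht m n hm h
  · refine (abs_sub_comm _ _).trans_le ?_
    exact hle k t ht n m hn h
end
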